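/- Let 0 < α < β < ∞. There is a set G₂ ⊆ [0,1] of full Lebesgue measure such that for every ω ∈ G₂, liminf_{n→∞} n^{1/α} x_n(ω) ≥ (α 2^α p₁)^{-1/α} = (1/2)(α p₁)^{-1/α}. -/

import Mathlib

open MeasureTheory Filter Set Topology

noncomputable section

/-- The Liverani–Saussol–Vaienti map `T_a` on `[0,1]`. -/
def lsv (a x : ℝ) : ℝ := if x ≤ 1 / 2 then x * (1 + (2 : ℝ) ^ a * x ^ a) else 2 * x - 1

/-- Random parameter selection: `α` on `[0,p₁)`, `β` on `[p₁,1]`. -/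
def alphaOf (α β p₁ ω : ℝ) : ℝ := if ω < p₁ then α else β

/-- The noise dynamics `φ` on `[0,1]`. -/
def phiMap (p₁ ω : ℝ) : ℝ := if ω < p₁ then ω / p₁ else (ω - p₁) / (1 - p₁)

/-- The skew product `S(x,ω) = (T_{α(ω)} x, φ ω)`. -/
def skewLSV (α β p₁ : ℝ) (p : ℝ × ℝ) : ℝ × ℝ :=
  (lsv (alphaOf α β p₁ p.2) p.1, phiMap p₁ p.2)

/-- The base of inducing, `Δ₀ = (1/2,1] × [0,1]`. -/
def Δ0 : Set (ℝ × ℝ) := Ioc (1 / 2 : ℝ) 1 ×ˢ Icc (0 : ℝ) 1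

lemma one_sub_mul_le_one_add_rpow_neg {γ t : ℝ} (hγ : 0 < γ) (ht : 0 ≤ t) :
    1 - γ * t ≤ (1 + t) ^ (-γ) := by
  have h1 : Real.log (1 + t) ≤ t := by
    have := Real.log_le_sub_one_of_pos (show 0 < 1 + t by linarith)
    linarith
  rw [Real.rpow_def_of_pos (by linarith)]
  have h2 := Real.add_one_le_exp (Real.log (1 + t) * -γ)
  nlinarith

lemma one_add_rpow_neg_le {γ t : ℝ} (hγ : 0 < γ) (ht : 0 ≤ t) (ht1 : t ≤ 1) :
    (1 + t) ^ (-γ) ≤ 1 - (1 - Real.exp (-(γ / 2))) * t := by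
  have h1 : t / 2 ≤ Real.log (1 + t) := by
    have h := Real.one_sub_inv_le_log_of_pos (show 0 < 1 + t by linarith)
    have h' : t / 2 ≤ 1 - (1 + t)⁻¹ := by
      have : 1 - (1 + t)⁻¹ = t / (1 + t) := by field_simp; ring
      rw [this]
      exact div_le_div_of_nonneg_left ht (by linarith) (by linarith)
    linarith
  rw [Real.rpow_def_of_pos (by linarith)]
  have h2 : Real.exp (Real.log (1 + t) * -γ) ≤ Real.exp (t * (-(γ / 2)) + (1 - t) * 0) :=
    Real.exp_le_exp.2 (by nlinarith)
  have h3 := convexOn_exp.2 (mem_univ (-(γ / 2))) (mem_univ 0) ht (sub_nonneg.2 ht1) (by ring)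
  simp only [smul_eq_mul, Real.exp_zero] at h3
  linarith

/-- One step of an inverse LSV branch changes `y ^ (-γ)` by at most the linear term. -/
lemma rpow_neg_le_of_step {γ t y : ℝ} (hγ : 0 < γ) (ht : 0 ≤ t) (hy : 0 < y) :
    y ^ (-γ) ≤ (y * (1 + t)) ^ (-γ) + γ * (t * y ^ (-γ)) := by
  rw [Real.mul_rpow hy.le (by linarith)]
  have := mul_le_mul_of_nonneg_left (one_sub_mul_le_one_add_rpow_neg hγ ht)
    (Real.rpow_nonneg hy.le (-γ))
  linarith

lemma rpow_neg_step_le {γ t y : ℝ} (hγ : 0 < γ) (ht : 0 ≤ t) (ht1 : t ≤ 1) (hy : 0 < y) :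
    (y * (1 + t)) ^ (-γ) + (1 - Real.exp (-(γ / 2))) * (t * y ^ (-γ)) ≤ y ^ (-γ) := by
  rw [Real.mul_rpow hy.le (by linarith)]
  have := mul_le_mul_of_nonneg_left (one_add_rpow_neg_le hγ ht ht1)
    (Real.rpow_nonneg hy.le (-γ))
  linarith

lemma two_rpow_mul_rpow_mul_rpow_neg {a γ y : ℝ} (hy : 0 < y) :
    ((2 : ℝ) ^ a * y ^ a) * y ^ (-γ) = 2 ^ a * y ^ (a - γ) := by
  rw [mul_assoc, ← Real.rpow_add hy, sub_eq_add_neg]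

lemma two_rpow_mul_rpow_le_one {a y : ℝ} (ha : 0 < a) (hy : 0 < y) (hy2 : y ≤ 1 / 2) :
    (2 : ℝ) ^ a * y ^ a ≤ 1 := by
  rw [← Real.mul_rpow (by norm_num) hy.le]
  exact Real.rpow_le_one (by positivity) (by linarith) ha.le

/-- Number of visits of the noise orbit to `[0,p)` before time `n`. -/
def visits (p : ℝ) (n : ℕ) (ω : ℝ) : ℝ :=
  ∑ i ∈ Finset.range n, (Iio p).indicator (fun _ => (1 : ℝ)) ((phiMap p)^[i] ω)

lemma visits_succ (p : ℝ) (n : ℕ) (ω : ℝ) :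
    visits p (n + 1) ω = visits p n (phiMap p ω) + if ω < p then 1 else 0 := by
  rw [visits, Finset.sum_range_succ']
  rfl

lemma visits_nonneg (p : ℝ) (n : ℕ) (ω : ℝ) : 0 ≤ visits p n ω :=
  Finset.sum_nonneg fun _ _ => indicator_nonneg (fun _ _ => zero_le_one) _

/-- The random preimage sequence, indexed from `0`. -/
structure IsRandomPreimage (α β p : ℝ) (Y : ℕ → ℝ → ℝ) : Prop where
  zero : ∀ ω, Y 0 ω = 1 / 2
  pos : ∀ n ω, 0 < Y n ω
  le_half : ∀ n ω, Y n ω ≤ 1 / 2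
  step : ∀ n ω, Y n (phiMap p ω) = Y (n + 1) ω *
    (1 + (2 : ℝ) ^ alphaOf α β p ω * Y (n + 1) ω ^ alphaOf α β p ω)

namespace IsRandomPreimage

variable {α β p : ℝ} {Y : ℕ → ℝ → ℝ}

lemma uniform_lower (h : IsRandomPreimage α β p Y) (hα : 0 < α) (hαβ : α < β) (n : ℕ) :
    ∀ ω, (1 - Real.exp (-(β / 2))) * 2 ^ β * n ≤ Y n ω ^ (-β) := by
  have hβ := hα.trans hαβ
  induction n with
  | zero => intro ω; simpa using Real.rpow_nonneg (h.pos 0 ω).le _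
  | succ n ih =>
    intro ω
    have hy := h.pos (n + 1) ω
    have hy2 := h.le_half (n + 1) ω
    have ht : (0 : ℝ) ≤ 2 ^ β * Y (n + 1) ω ^ β := by positivity
    have h1 := rpow_neg_step_le hβ ht (two_rpow_mul_rpow_le_one hβ hy hy2) hy
    rw [two_rpow_mul_rpow_mul_rpow_neg hy, sub_self, Real.rpow_zero, mul_one] at h1
    have h2 : (Y n (phiMap p ω)) ^ (-β) ≤
        (Y (n + 1) ω * (1 + 2 ^ β * Y (n + 1) ω ^ β)) ^ (-β) := by
      refine Real.rpow_le_rpow_of_nonpos (by positivity) ?_ (by linarith)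
      rw [h.step]
      refine mul_le_mul_of_nonneg_left ?_ hy.le
      have : (2 : ℝ) ^ β * Y (n + 1) ω ^ β ≤
          2 ^ alphaOf α β p ω * Y (n + 1) ω ^ alphaOf α β p ω := by
        rw [← Real.mul_rpow (by norm_num) hy.le, ← Real.mul_rpow (by norm_num) hy.le]
        refine Real.rpow_le_rpow_of_exponent_ge (by positivity) (by linarith) ?_
        unfold alphaOf; split_ifs <;> linarith
      linarith
    have h3 := ih (phiMap p ω)
    push_cast
    linarith

lemma lower (h : IsRandomPreimage α β p Y) (hα : 0 < α) (n : ℕ) :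
    ∀ ω, (1 - Real.exp (-(α / 2))) * 2 ^ α * visits p n ω ≤ Y n ω ^ (-α) := by
  induction n with
  | zero => intro ω; simpa [visits] using Real.rpow_nonneg (h.pos 0 ω).le _
  | succ n ih =>
    intro ω
    have hy := h.pos (n + 1) ω
    have hy2 := h.le_half (n + 1) ω
    have h3 := ih (phiMap p ω)
    have hs := h.step n ω
    rw [visits_succ]
    unfold alphaOf at hs
    split_ifs at hs ⊢ with hω
    · have ht : (0 : ℝ) ≤ 2 ^ α * Y (n + 1) ω ^ α := by positivity
      have h1 := rpow_neg_step_le hα ht (two_rpow_mul_rpow_le_one hα hy hy2) hy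
      rw [two_rpow_mul_rpow_mul_rpow_neg hy, sub_self, Real.rpow_zero, mul_one, ← hs] at h1
      linarith
    · have h1 : Y n (phiMap p ω) ^ (-α) ≤ Y (n + 1) ω ^ (-α) := by
        refine Real.rpow_le_rpow_of_nonpos hy ?_ (by linarith)
        rw [hs]
        have ht : (0 : ℝ) ≤ 2 ^ β * Y (n + 1) ω ^ β := by positivity
        exact le_mul_of_one_le_right hy.le (by linarith)
      linarith

lemma upper (h : IsRandomPreimage α β p Y) (hα : 0 < α) {e : ℕ → ℝ} (he0 : ∀ n, 0 ≤ e n)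
    (he : ∀ n ω, α * (2 ^ β * Y (n + 1) ω ^ (β - α)) ≤ e n) (n : ℕ) :
    ∀ ω, Y n ω ^ (-α) ≤
      2 ^ α + α * 2 ^ α * visits p n ω + ∑ k ∈ Finset.range n, e k := by
  induction n with
  | zero => intro ω; simp [visits, h.zero, Real.rpow_neg, Real.inv_rpow]
  | succ n ih =>
    intro ω
    have hy := h.pos (n + 1) ω
    have h3 := ih (phiMap p ω)
    have hs := h.step n ω
    rw [visits_succ, Finset.sum_range_succ]
    unfold alphaOf at hs
    split_ifs at hs ⊢ with hω
    · have ht : (0 : ℝ) ≤ 2 ^ α * Y (n + 1) ω ^ α := by positivity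
      have h1 := rpow_neg_le_of_step hα ht hy
      rw [two_rpow_mul_rpow_mul_rpow_neg hy, sub_self, Real.rpow_zero, mul_one, ← hs] at h1
      linarith [he0 n]
    · have ht : (0 : ℝ) ≤ 2 ^ β * Y (n + 1) ω ^ β := by positivity
      have h1 := rpow_neg_le_of_step hα ht hy
      rw [two_rpow_mul_rpow_mul_rpow_neg hy, ← hs] at h1
      linarith [he n ω]

/-- The steps with parameter `β` contribute a uniformly vanishing increment. -/
lemma exists_error (h : IsRandomPreimage α β p Y) (hα : 0 < α) (hαβ : α < β) :
    ∃ e : ℕ → ℝ, (∀ n, 0 ≤ e n) ∧ Tendsto e atTop (𝓝 0) ∧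
      ∀ n ω, α * (2 ^ β * Y (n + 1) ω ^ (β - α)) ≤ e n := by
  have hβ := hα.trans hαβ
  have hc : 0 < (1 - Real.exp (-(β / 2))) * 2 ^ β :=
    mul_pos (sub_pos.2 (Real.exp_lt_one_iff.2 (by linarith))) (by positivity)
  set c := (1 - Real.exp (-(β / 2))) * 2 ^ β
  refine ⟨fun n => α * (2 ^ β * (c * (n + 1 : ℕ)) ^ (-((β - α) / β))), fun n => by positivity,
    ?_, fun n ω => ?_⟩
  · have h1 : Tendsto (fun n : ℕ => c * ((n + 1 : ℕ) : ℝ)) atTop atTop :=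
      (tendsto_natCast_atTop_atTop.comp (tendsto_add_atTop_nat 1)).const_mul_atTop hc
    have h2 := (tendsto_rpow_neg_atTop (div_pos (sub_pos.2 hαβ) hβ)).comp h1
    simpa using (h2.const_mul (2 ^ β)).const_mul α
  · have hy := h.pos (n + 1) ω
    have h1 := h.uniform_lower hα hαβ (n + 1) ω
    have h2 : Y (n + 1) ω ^ (β - α) = (Y (n + 1) ω ^ (-β)) ^ (-((β - α) / β)) := by
      rw [← Real.rpow_mul hy.le]; congr 1; field_simp
    have h3 : Y (n + 1) ω ^ (β - α) ≤ (c * (n + 1 : ℕ)) ^ (-((β - α) / β)) := by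
      rw [h2]
      refine Real.rpow_le_rpow_of_nonpos (by positivity) h1 ?_
      have := div_pos (sub_pos.2 hαβ) hβ
      linarith
    exact mul_le_mul_of_nonneg_left (mul_le_mul_of_nonneg_left h3 (by positivity)) hα.le

lemma le_liminf (h : IsRandomPreimage α β p Y) (hα : 0 < α) (hαβ : α < β) (hp : 0 < p) {ω : ℝ}
    (hω : Tendsto (fun n : ℕ => visits p n ω / n) atTop (𝓝 p)) :
    (α * (2 : ℝ) ^ α * p) ^ (-(1 / α)) ≤
      liminf (fun n : ℕ => ((n + 1 : ℕ) : ℝ) ^ (1 / α) * Y n ω) atTop := by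
  obtain ⟨e, he0, he, heY⟩ := h.exists_error hα hαβ
  set c := (1 - Real.exp (-(α / 2))) * (2 : ℝ) ^ α
  have hc : 0 < c := mul_pos (sub_pos.2 (Real.exp_lt_one_iff.2 (by linarith))) (by positivity)
  have hn1 : Tendsto (fun n : ℕ => ((n + 1 : ℕ) : ℝ) / n) atTop (𝓝 1) := by
    have : Tendsto (fun n : ℕ => 1 + (n : ℝ)⁻¹) atTop (𝓝 (1 + 0)) :=
      tendsto_const_nhds.add tendsto_inv_atTop_nhds_zero_nat
    rw [add_zero] at this
    refine this.congr' ?_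
    filter_upwards [eventually_gt_atTop 0] with n hn
    have : (n : ℝ) ≠ 0 := by positivity
    push_cast; field_simp
  set D : ℕ → ℝ := fun n =>
    2 ^ α + α * 2 ^ α * visits p n ω + ∑ k ∈ Finset.range n, e k with hD
  have hDt : Tendsto (fun n : ℕ => D n / n) atTop (𝓝 (α * 2 ^ α * p)) := by
    have h1 : Tendsto (fun n : ℕ => 2 ^ α * (n : ℝ)⁻¹ + α * 2 ^ α * (visits p n ω / n) +
        (n : ℝ)⁻¹ * ∑ k ∈ Finset.range n, e k) atTop (𝓝 (2 ^ α * 0 + α * 2 ^ α * p + 0)) :=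
      ((tendsto_inv_atTop_nhds_zero_nat.const_mul _).add (hω.const_mul _)).add he.cesaro
    rw [mul_zero, zero_add, add_zero] at h1
    refine h1.congr fun n => ?_
    simp only [hD]; ring
  have hpos : 0 < α * 2 ^ α * p := by positivity
  have key : ∀ n, ((n + 1 : ℕ) : ℝ) ^ (1 / α) * Y n ω =
      (((n + 1 : ℕ) : ℝ) / Y n ω ^ (-α)) ^ (1 / α) := fun n => by
    have hy := h.pos n ω
    rw [Real.rpow_neg hy.le, div_inv_eq_mul, Real.mul_rpow (by positivity) (by positivity),
      ← Real.rpow_mul hy.le, mul_one_div_cancel hα.ne', Real.rpow_one]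
  have hlow : Tendsto (fun n : ℕ => (((n + 1 : ℕ) : ℝ) / D n) ^ (1 / α)) atTop
      (𝓝 ((α * (2 : ℝ) ^ α * p) ^ (-(1 / α)))) := by
    have h1 := (hn1.div hDt hpos.ne').rpow_const (p := 1 / α) (Or.inr (by positivity))
    rw [one_div (α * 2 ^ α * p), Real.inv_rpow hpos.le, ← Real.rpow_neg hpos.le] at h1
    refine h1.congr' ?_
    filter_upwards [eventually_gt_atTop 0] with n hn
    have : (n : ℝ) ≠ 0 := by positivity
    simp only [Pi.div_apply]
    rw [div_div_div_cancel_right₀ this]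
  have hup : Tendsto (fun n : ℕ => (((n + 1 : ℕ) : ℝ) / (c * visits p n ω)) ^ (1 / α)) atTop
      (𝓝 ((1 / (c * p)) ^ (1 / α))) := by
    have h1 := (hn1.div (hω.const_mul c) (by positivity)).rpow_const (p := 1 / α)
      (Or.inr (by positivity))
    refine h1.congr' ?_
    filter_upwards [eventually_gt_atTop 0] with n hn
    have : (n : ℝ) ≠ 0 := by positivity
    simp only [Pi.div_apply]
    rw [← mul_div_assoc, div_div_div_cancel_right₀ this]
  have hvis : ∀ᶠ n : ℕ in atTop, 0 < visits p n ω := by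
    filter_upwards [hω.eventually (lt_mem_nhds hp), eventually_gt_atTop 0] with n hn hn0
    have : (0 : ℝ) < n := by positivity
    exact (div_pos_iff_of_pos_right this).1 hn
  have hbdd : IsBoundedUnder (· ≤ ·) atTop
      (fun n : ℕ => ((n + 1 : ℕ) : ℝ) ^ (1 / α) * Y n ω) := by
    refine hup.isBoundedUnder_le.mono_le ?_
    filter_upwards [hvis] with n hn
    rw [key]
    exact Real.rpow_le_rpow (div_nonneg (by positivity) (Real.rpow_nonneg (h.pos n ω).le _))
      (div_le_div_of_nonneg_left (by positivity) (by positivity) (h.lower hα n ω)) (by positivity)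
  rw [← hlow.liminf_eq]
  refine liminf_le_liminf (Eventually.of_forall fun n => ?_) hlow.isBoundedUnder_ge
    hbdd.isCoboundedUnder_ge
  have hy := Real.rpow_pos_of_pos (h.pos n ω) (-α)
  have hu := h.upper hα he0 heY n ω
  rw [key]
  exact Real.rpow_le_rpow (div_nonneg (by positivity) (hy.le.trans hu))
    (div_le_div_of_nonneg_left (by positivity) hy hu) (by positivity)

end IsRandomPreimage

lemma measurable_phiMap (p : ℝ) : Measurable (phiMap p) :=
  Measurable.ite measurableSet_Iio (by fun_prop) (by fun_prop)

lemma volume_Ico_inter_phiMap_left {p : ℝ} (hp : 0 < p) (hp1 : p < 1) (B : Set ℝ) :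
    volume (Iio p ∩ phiMap p ⁻¹' B ∩ Ico 0 1) =
      ENNReal.ofReal p * volume (B ∩ Ico 0 1) := by
  have h : Iio p ∩ phiMap p ⁻¹' B ∩ Ico 0 1 = (fun x => x * p⁻¹) ⁻¹' (B ∩ Ico 0 1) := by
    ext x
    simp only [mem_inter_iff, mem_Iio, mem_preimage, mem_Ico, ← div_eq_mul_inv]
    rw [div_lt_one hp, le_div_iff₀ hp, zero_mul]
    constructor
    · rintro ⟨⟨h1, h2⟩, h3, h4⟩
      rw [phiMap, if_pos h1] at h2
      exact ⟨h2, h3, h1⟩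
    · rintro ⟨h2, h3, h1⟩
      refine ⟨⟨h1, ?_⟩, h3, h1.trans hp1⟩
      rwa [phiMap, if_pos h1]
  rw [h, Real.volume_preimage_mul_right (inv_ne_zero hp.ne'), inv_inv, abs_of_pos hp]

lemma volume_Ico_inter_phiMap_right {p : ℝ} (hp : 0 < p) (hp1 : p < 1) (B : Set ℝ) :
    volume (Ici p ∩ phiMap p ⁻¹' B ∩ Ico 0 1) =
      ENNReal.ofReal (1 - p) * volume (B ∩ Ico 0 1) := by
  have hq : 0 < 1 - p := sub_pos.2 hp1
  have h : Ici p ∩ phiMap p ⁻¹' B ∩ Ico 0 1 =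
      (fun x => x + -p) ⁻¹' ((fun x => x * (1 - p)⁻¹) ⁻¹' (B ∩ Ico 0 1)) := by
    ext x
    simp only [mem_inter_iff, mem_Ici, mem_preimage, mem_Ico, ← div_eq_mul_inv, ← sub_eq_add_neg]
    rw [div_lt_one hq, le_div_iff₀ hq, zero_mul, sub_nonneg, sub_lt_sub_iff_right]
    constructor
    · rintro ⟨⟨h1, h2⟩, h3, h4⟩
      rw [phiMap, if_neg h1.not_gt] at h2
      exact ⟨h2, h1, h4⟩
    · rintro ⟨h2, h1, h4⟩
      refine ⟨⟨h1, ?_⟩, hp.le.trans h1, h4⟩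
      rwa [phiMap, if_neg h1.not_gt]
  rw [h, measure_preimage_add_right, Real.volume_preimage_mul_right (inv_ne_zero hq.ne'), inv_inv,
    abs_of_pos hq]

/-- Lebesgue measure on `[0,1)`. -/
def unitVolume : Measure ℝ := volume.restrict (Ico 0 1)

instance : IsProbabilityMeasure unitVolume := ⟨by simp [unitVolume]⟩

lemma unitVolume_Iio_inter {p : ℝ} (hp : 0 < p) (hp1 : p < 1) (B : Set ℝ) :
    unitVolume (Iio p ∩ phiMap p ⁻¹' B) = ENNReal.ofReal p * unitVolume B := by
  rw [unitVolume, Measure.restrict_apply' measurableSet_Ico,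
    Measure.restrict_apply' measurableSet_Ico,
    volume_Ico_inter_phiMap_left hp hp1]

lemma unitVolume_Ici_inter {p : ℝ} (hp : 0 < p) (hp1 : p < 1) (B : Set ℝ) :
    unitVolume (Ici p ∩ phiMap p ⁻¹' B) = ENNReal.ofReal (1 - p) * unitVolume B := by
  rw [unitVolume, Measure.restrict_apply' measurableSet_Ico,
    Measure.restrict_apply' measurableSet_Ico,
    volume_Ico_inter_phiMap_right hp hp1]

lemma unitVolume_Iio {p : ℝ} (hp : 0 < p) (hp1 : p < 1) :
    unitVolume (Iio p) = ENNReal.ofReal p := by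
  simpa using unitVolume_Iio_inter hp hp1 univ

lemma unitVolume_Ici {p : ℝ} (hp : 0 < p) (hp1 : p < 1) :
    unitVolume (Ici p) = ENNReal.ofReal (1 - p) := by
  simpa using unitVolume_Ici_inter hp hp1 univ

lemma measurePreserving_phiMap {p : ℝ} (hp : 0 < p) (hp1 : p < 1) :
    MeasurePreserving (phiMap p) unitVolume unitVolume := by
  refine ⟨measurable_phiMap p, Measure.ext fun B hB => ?_⟩
  rw [Measure.map_apply (measurable_phiMap p) hB,
    ← measure_inter_add_sdiff _ (measurableSet_Iio (a := p)), inter_comm, sdiff_eq,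
    inter_comm _ (Iio p)ᶜ, compl_Iio, unitVolume_Iio_inter hp hp1, unitVolume_Ici_inter hp hp1, ← add_mul,
    ← ENNReal.ofReal_add hp.le (by linarith)]
  simp

/-- Which branch `ω` lies in is independent of `phiMap p ω`. -/
lemma unitVolume_indicator_inter {p : ℝ} (hp : 0 < p) (hp1 : p < 1) (s B : Set ℝ)
    (hB : MeasurableSet B) :
    unitVolume ((Iio p).indicator (fun _ => (1 : ℝ)) ⁻¹' s ∩ phiMap p ⁻¹' B) =
      unitVolume ((Iio p).indicator (fun _ => (1 : ℝ)) ⁻¹' s) * unitVolume B := by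
  have hmp := (measurePreserving_phiMap hp hp1).measure_preimage hB.nullMeasurableSet
  rcases indicator_const_preimage (Iio p) s (1 : ℝ) with h | h | h | h <;> rw [h]
  · simp [hmp]
  · rw [unitVolume_Iio_inter hp hp1, unitVolume_Iio hp hp1]
  · rw [compl_Iio, unitVolume_Ici_inter hp hp1, unitVolume_Ici hp hp1]
  · simp

open ProbabilityTheory in
lemma ae_tendsto_visits {p : ℝ} (hp : 0 < p) (hp1 : p < 1) :
    ∀ᵐ ω ∂unitVolume, Tendsto (fun n : ℕ => visits p n ω / n) atTop (𝓝 p) := by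
  set f : ℝ → ℝ := (Iio p).indicator (fun _ => (1 : ℝ)) with hf
  have hfm : Measurable f := measurable_const.indicator measurableSet_Iio
  have hmp := fun n => (measurePreserving_phiMap hp hp1).iterate n
  have hXm : ∀ n, Measurable fun ω => f ((phiMap p)^[n] ω) := fun n => hfm.comp (hmp n).measurable
  have hlt : ∀ i k, IndepFun (fun ω => f ((phiMap p)^[i] ω))
      (fun ω => f ((phiMap p)^[i + k + 1] ω)) unitVolume := fun i k => by
    rw [indepFun_iff_measure_inter_preimage_eq_mul]
    intro s t hs ht
    have hB : MeasurableSet ((phiMap p)^[k] ⁻¹' (f ⁻¹' t)) := (hmp k).measurable (hfm ht)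
    have e1 : (fun ω => f ((phiMap p)^[i] ω)) ⁻¹' s = (phiMap p)^[i] ⁻¹' (f ⁻¹' s) := rfl
    have e2 : (fun ω => f ((phiMap p)^[i + k + 1] ω)) ⁻¹' t =
        (phiMap p)^[i] ⁻¹' (phiMap p ⁻¹' ((phiMap p)^[k] ⁻¹' (f ⁻¹' t))) := by
      ext ω
      simp only [mem_preimage]
      rw [show i + k + 1 = k + (i + 1) by omega, Function.iterate_add_apply,
        Function.iterate_succ_apply']
    have hB' := measurable_phiMap p hB
    rw [e1, e2, ← preimage_inter, (hmp i).measure_preimage ((hfm hs).inter hB').nullMeasurableSet,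
      (hmp i).measure_preimage (hfm hs).nullMeasurableSet,
      (hmp i).measure_preimage hB'.nullMeasurableSet,
      (measurePreserving_phiMap hp hp1).measure_preimage hB.nullMeasurableSet,
      unitVolume_indicator_inter hp hp1 s _ hB]
  have hind : Pairwise (Function.onFun (fun X Y : ℝ → ℝ => IndepFun X Y unitVolume)
      (fun n ω => f ((phiMap p)^[n] ω))) := by
    intro i j hij
    rcases lt_or_gt_of_ne hij with h | h
    · obtain ⟨k, rfl⟩ := Nat.exists_eq_add_of_lt h
      exact hlt i k
    · obtain ⟨k, rfl⟩ := Nat.exists_eq_add_of_lt h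
      exact (hlt j k).symm
  have hid : ∀ i, IdentDistrib (fun ω => f ((phiMap p)^[i] ω)) (fun ω => f ((phiMap p)^[0] ω))
      unitVolume unitVolume := fun i => by
    refine ⟨(hXm i).aemeasurable, (hXm 0).aemeasurable, ?_⟩
    change unitVolume.map (f ∘ (phiMap p)^[i]) = unitVolume.map f
    rw [← Measure.map_map hfm (hmp i).measurable, (hmp i).map_eq]
  have hint : Integrable (fun ω => f ((phiMap p)^[0] ω)) unitVolume :=
    (integrable_const (1 : ℝ)).indicator measurableSet_Iio
  have hE : ∫ ω, f ((phiMap p)^[0] ω) ∂unitVolume = p := by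
    simp only [Function.iterate_zero, id, hf]
    rw [integral_indicator measurableSet_Iio, setIntegral_const, Measure.real,
      unitVolume_Iio hp hp1, ENNReal.toReal_ofReal hp.le, smul_eq_mul, mul_one]
  have := strong_law_ae_real (μ := unitVolume) (fun n ω => f ((phiMap p)^[n] ω)) hint hind hid
  rw [hE] at this
  exact this

/-- Lemma 2.4: there is a full-measure set `G₂ ⊆ [0,1]` on which
`liminf n^{1/α} x_n(ω) ≥ (α 2^α p₁)^{-1/α} = (1/2)(α p₁)^{-1/α}`. -/
theorem liminf_lower_bound (α β p₁ : ℝ) (hα : 0 < α) (hαβ : α < β)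
    (hp₁ : 0 < p₁) (hp₁' : p₁ < 1)
    (X : ℕ → ℝ → ℝ) (hX1 : ∀ ω, X 1 ω = 1 / 2)
    (hX : ∀ n, 2 ≤ n → ∀ ω, X n ω ∈ Ioc (0 : ℝ) (1 / 2) ∧
      lsv (alphaOf α β p₁ ω) (X n ω) = X (n - 1) (phiMap p₁ ω)) :
    (∃ G₂ : Set ℝ, G₂ ⊆ Icc (0 : ℝ) 1 ∧ volume G₂ = 1 ∧
      ∀ ω ∈ G₂,
        (α * (2 : ℝ) ^ α * p₁) ^ (-(1 / α)) ≤
          Filter.liminf (fun n : ℕ => (n : ℝ) ^ (1 / α) * X n ω) atTop) ∧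
    (α * (2 : ℝ) ^ α * p₁) ^ (-(1 / α)) = (1 / 2 : ℝ) * (α * p₁) ^ (-(1 / α)) := by
  have hY : IsRandomPreimage α β p₁ (fun n => X (n + 1)) :=
    { zero := hX1
      pos := fun n ω => by
        rcases n with _ | n
        · simp [hX1]
        · exact (hX (n + 2) (by omega) ω).1.1
      le_half := fun n ω => by
        rcases n with _ | n
        · simp [hX1]
        · exact (hX (n + 2) (by omega) ω).1.2
      step := fun n ω => by
        have h := hX (n + 2) (by omega) ω
        rw [lsv, if_pos h.1.2] at h
        exact h.2.symm }
  refine ⟨⟨{ω | Tendsto (fun n : ℕ => visits p₁ n ω / n) atTop (𝓝 p₁)} ∩ Ico 0 1,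
    fun ω hω => Ico_subset_Icc_self hω.2, ?_, fun ω hω => ?_⟩, ?_⟩
  · rw [← Measure.restrict_apply' measurableSet_Ico]
    exact (measure_congr (eventuallyEq_univ.2 (ae_tendsto_visits hp₁ hp₁'))).trans
      (measure_univ (μ := unitVolume))
  · rw [← liminf_nat_add (fun n : ℕ => (n : ℝ) ^ (1 / α) * X n ω) 1]
    exact hY.le_liminf hα hαβ hp₁ hω.1
  · rw [mul_right_comm, Real.mul_rpow (by positivity) (by positivity),
      ← Real.rpow_mul (by norm_num), mul_neg, mul_one_div_cancel hα.ne', Real.rpow_neg_one]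
    ring
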